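/- arXiv:2007.15893 — 2 statements merged into one kernel-verified Lean document; each statement's English description precedes it below -/
import Mathlib

section
/- Let Φ : M_n(ℂ) → M_n(ℂ) be an entanglement breaking channel with rank-one Kraus operators {v_i w_i*}_{i=1}^d, and let P_1, …, P_r be mutually orthogonal projections summing to the identity, each belonging to the multiplicative domain M_{Φ†} of the dual map Φ†. Then for every index i ∈ {1, …, d} there is a unique k ∈ {1, …, r} such that P_k v_i = v_i. -/
open Matrix

open scoped ComplexOrder in
lemma aux_kill {n d : ℕ} (w : Fin d → (Fin n → ℂ)) (a : Fin d → ℂ) (ha : ∀ i, 0 ≤ a i)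
    (y : Fin n → ℂ)
    (hy : (∑ i, a i • Matrix.vecMulVec (w i) (star (w i))) *ᵥ y = 0) (i : Fin d)
    (hi : a i ≠ 0) : star (w i) ⬝ᵥ y = 0 := by
  have h1 : ∑ i, a i * (star (star (w i) ⬝ᵥ y) * (star (w i) ⬝ᵥ y)) = 0 := by
    have h2 : star y ⬝ᵥ ((∑ i, a i • Matrix.vecMulVec (w i) (star (w i))) *ᵥ y) = 0 := by
      rw [hy, dotProduct_zero]
    rw [← h2, Matrix.sum_mulVec, dotProduct_sum]
    refine Finset.sum_congr rfl fun j _ => ?_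
    rw [Matrix.smul_mulVec, Matrix.vecMulVec_mulVec, dotProduct_smul, dotProduct_smul,
      ← Matrix.star_dotProduct]
    simp
  rw [Finset.sum_eq_zero_iff_of_nonneg
    (fun j _ => mul_nonneg (ha j) (star_mul_self_nonneg _))] at h1
  have := h1 i (Finset.mem_univ i)
  simpa [hi] using this


/-- **part of Lemma on multiplicative domains of EB channel duals.**
Let `Φ(ρ) = Σ_i (w_i* ρ w_i) v_i v_i*` be an entanglement breaking channel with rank-one
Kraus operators `v_i w_i*` (`‖v_i‖ = 1`, `w_i ≠ 0`, `Σ_i w_i w_i* = I`), with dual map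
`Φ†(X) = Σ_i (v_i* X v_i) w_i w_i*`. If `P_1, …, P_r` are mutually orthogonal projections
summing to the identity, each in the multiplicative domain of `Φ†`, then for every `i`
there is a unique `k` with `P_k v_i = v_i`. -/
theorem unique_projection_fixing_v {n d r : ℕ}
    (Φ Φd : Matrix (Fin n) (Fin n) ℂ → Matrix (Fin n) (Fin n) ℂ)
    (v w : Fin d → (Fin n → ℂ))
    (hv : ∀ i, star (v i) ⬝ᵥ v i = 1)
    (hw : ∀ i, w i ≠ 0)
    (hTP : ∑ i, Matrix.vecMulVec (w i) (star (w i)) = 1)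
    (hΦ : ∀ X, Φ X = ∑ i, (star (w i) ⬝ᵥ (X *ᵥ w i)) • Matrix.vecMulVec (v i) (star (v i)))
    (hΦd : ∀ X, Φd X = ∑ i, (star (v i) ⬝ᵥ (X *ᵥ v i)) • Matrix.vecMulVec (w i) (star (w i)))
    (P : Fin r → Matrix (Fin n) (Fin n) ℂ)
    (hPherm : ∀ k, (P k)ᴴ = P k)
    (hPidem : ∀ k, P k * P k = P k)
    (hPorth : ∀ k l, k ≠ l → P k * P l = 0)
    (hPsum : ∑ k, P k = 1)
    (hPdom : ∀ k X, Φd (P k * X) = Φd (P k) * Φd X ∧ Φd (X * P k) = Φd X * Φd (P k)) :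
    ∀ i : Fin d, ∃! k : Fin r, P k *ᵥ v i = v i := by
  classical
  have key : ∀ k i, star (v i) ⬝ᵥ (P k *ᵥ v i) = star (P k *ᵥ v i) ⬝ᵥ (P k *ᵥ v i) := by
    intro k i
    rw [Matrix.star_mulVec, hPherm, ← Matrix.dotProduct_mulVec, Matrix.mulVec_mulVec, hPidem]
  have kill : ∀ k i y, Φd (P k) *ᵥ y = 0 → P k *ᵥ v i ≠ 0 → star (w i) ⬝ᵥ y = 0 := by
    intro k i y hy hne
    rw [hΦd] at hy
    refine aux_kill w (fun i => star (v i) ⬝ᵥ (P k *ᵥ v i)) ?_ y hy i ?_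
    · intro j
      rw [key]
      open scoped ComplexOrder in exact dotProduct_star_self_nonneg _
    · show star (v i) ⬝ᵥ (P k *ᵥ v i) ≠ 0
      rw [key]
      intro h
      open scoped ComplexOrder in exact hne (dotProduct_star_self_eq_zero.1 h)
  have h0 : Φd 0 = 0 := by rw [hΦd]; simp
  have excl : ∀ i k l, k ≠ l → P k *ᵥ v i ≠ 0 → P l *ᵥ v i ≠ 0 → False := by
    intro i k l hkl hk hl
    have h1 := kill k i (Φd (P l) *ᵥ w i)
      (by rw [Matrix.mulVec_mulVec, ← (hPdom k (P l)).1, hPorth k l hkl, h0, Matrix.zero_mulVec]) hk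
    have h2 := kill l i (w i - Φd (P l) *ᵥ w i)
      (by rw [Matrix.mulVec_sub, Matrix.mulVec_mulVec, ← (hPdom l (P l)).1, hPidem, sub_self]) hl
    rw [dotProduct_sub, h1, sub_zero] at h2
    open scoped ComplexOrder in exact hw i (dotProduct_star_self_eq_zero.1 h2)
  intro i
  have hvi : v i ≠ 0 := by
    intro h
    have := hv i
    simp [h] at this
  have hs : ∑ k, P k *ᵥ v i = v i := by
    rw [← Matrix.sum_mulVec, hPsum, Matrix.one_mulVec]
  obtain ⟨k, hk⟩ : ∃ k, P k *ᵥ v i ≠ 0 := by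
    by_contra! h
    exact hvi (by rw [← hs]; exact Finset.sum_eq_zero fun k _ => h k)
  refine ⟨k, ?_, ?_⟩
  · show P k *ᵥ v i = v i
    rw [Finset.sum_eq_single k] at hs
    · exact hs
    · intro l _ hl
      by_contra h
      exact excl i k l hl.symm hk h
    · simp
  · intro l hl
    by_contra h
    refine excl i k l (Ne.symm h) hk ?_
    show P l *ᵥ v i ≠ 0
    rw [show P l *ᵥ v i = v i from hl]
    exact hvi
end

section
/- Let Φ : M_n(ℂ) → M_n(ℂ) be an entanglement breaking channel with rank-one Kraus operators {v_i w_i*}_{i=1}^d, and let P_1, …, P_r be mutually orthogonal projections summing to the identity, each in the multiplicative domain M_{Φ†} of the dual map Φ†. Let Q_k be the orthogonal projection onto W_k = span{ w_i : P_k v_i = v_i }. Then for every X ∈ M_n(ℂ) and every 1 ≤ k ≤ r: Φ(Q_k X) = P_k Φ(X) = Φ(X) P_k = Φ(X Q_k). Consequently, if X = Q_k X Q_l with k ≠ l, then Φ(X) = 0. -/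
open Matrix

open scoped ComplexOrder in
theorem eb_aux1 {n d : ℕ} (w : Fin d → (Fin n → ℂ)) (a : Fin d → ℂ) (ha : ∀ i, 0 ≤ a i)
    (x : Fin n → ℂ)
    (h : (∑ i, a i • Matrix.vecMulVec (w i) (star (w i))) *ᵥ x = 0) (i : Fin d) (hi : a i ≠ 0) :
    star (w i) ⬝ᵥ x = 0 := by
  have h1 : ∑ i, a i * (star (star (w i) ⬝ᵥ x) * (star (w i) ⬝ᵥ x)) = 0 := by
    have h2 := congrArg (fun y => star x ⬝ᵥ y) h
    simp only [Matrix.sum_mulVec, dotProduct_sum, Matrix.smul_mulVec, Matrix.vecMulVec_mulVec,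
      dotProduct_smul, dotProduct_zero] at h2
    rw [← h2]
    refine Finset.sum_congr rfl fun i _ => ?_
    rw [← Matrix.star_dotProduct_star, star_star]
    simp
  rw [Finset.sum_eq_zero_iff_of_nonneg] at h1
  · have := h1 i (Finset.mem_univ i)
    simpa [hi] using this
  · intro j _
    exact mul_nonneg (ha j) (star_mul_self_nonneg _)

open scoped ComplexOrder in
theorem eb_aux2 {n : ℕ} (x : Fin n → ℂ) : 0 ≤ star x ⬝ᵥ x := dotProduct_star_self_nonneg x

open scoped ComplexOrder in
theorem eb_aux3 {n : ℕ} {x : Fin n → ℂ} : star x ⬝ᵥ x = 0 ↔ x = 0 := dotProduct_star_self_eq_zero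

/-- **part of Lemma on multiplicative domains of EB channel duals.**
With `Φ(ρ) = Σ_i (w_i* ρ w_i) v_i v_i*` entanglement breaking, dual map
`Φ†(X) = Σ_i (v_i* X v_i) w_i w_i*`, `P_1, …, P_r` mutually orthogonal projections summing
to the identity in the multiplicative domain of `Φ†`, and `Q_k` the orthogonal projection
onto `W_k = span{ w_i : P_k v_i = v_i }`, we have
`Φ(Q_k X) = P_k Φ(X) = Φ(X) P_k = Φ(X Q_k)` for all `X` and `k`; consequently
`X = Q_k X Q_l` with `k ≠ l` forces `Φ(X) = 0`. -/
theorem eb_channel_block_intertwining {n d r : ℕ}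
    (Φ Φd : Matrix (Fin n) (Fin n) ℂ → Matrix (Fin n) (Fin n) ℂ)
    (v w : Fin d → (Fin n → ℂ))
    (hv : ∀ i, star (v i) ⬝ᵥ v i = 1)
    (hw : ∀ i, w i ≠ 0)
    (hTP : ∑ i, Matrix.vecMulVec (w i) (star (w i)) = 1)
    (hΦ : ∀ X, Φ X = ∑ i, (star (w i) ⬝ᵥ (X *ᵥ w i)) • Matrix.vecMulVec (v i) (star (v i)))
    (hΦd : ∀ X, Φd X = ∑ i, (star (v i) ⬝ᵥ (X *ᵥ v i)) • Matrix.vecMulVec (w i) (star (w i)))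
    (P : Fin r → Matrix (Fin n) (Fin n) ℂ)
    (hPherm : ∀ k, (P k)ᴴ = P k)
    (hPidem : ∀ k, P k * P k = P k)
    (hPorth : ∀ k l, k ≠ l → P k * P l = 0)
    (hPsum : ∑ k, P k = 1)
    (hPdom : ∀ k X, Φd (P k * X) = Φd (P k) * Φd X ∧ Φd (X * P k) = Φd X * Φd (P k))
    (Q : Fin r → Matrix (Fin n) (Fin n) ℂ)
    (hQherm : ∀ k, (Q k)ᴴ = Q k)
    (hQidem : ∀ k, Q k * Q k = Q k)
    (hQrange : ∀ k, LinearMap.range (Q k).mulVecLin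
      = Submodule.span ℂ {x | ∃ i, P k *ᵥ v i = v i ∧ x = w i}) :
    (∀ (X : Matrix (Fin n) (Fin n) ℂ) (k : Fin r),
      Φ (Q k * X) = P k * Φ X ∧ P k * Φ X = Φ X * P k ∧ Φ X * P k = Φ (X * Q k)) ∧
    (∀ (X : Matrix (Fin n) (Fin n) ℂ) (k l : Fin r),
      k ≠ l → X = Q k * X * Q l → Φ X = 0) := by
  open scoped ComplexOrder in
  have hq : ∀ k i, star (v i) ⬝ᵥ (P k *ᵥ v i) = star (P k *ᵥ v i) ⬝ᵥ (P k *ᵥ v i) := by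
    intro k i
    rw [Matrix.star_mulVec, hPherm, ← Matrix.dotProduct_mulVec, Matrix.mulVec_mulVec, hPidem]
  have ha : ∀ k i, 0 ≤ star (v i) ⬝ᵥ (P k *ᵥ v i) := by
    intro k i
    rw [hq]
    exact eb_aux2 _
  have hz : ∀ k i, star (v i) ⬝ᵥ (P k *ᵥ v i) = 0 → P k *ᵥ v i = 0 := by
    intro k i h
    rw [hq] at h
    exact eb_aux3.mp h
  have hEherm : ∀ k, (Φd (P k))ᴴ = Φd (P k) := by
    intro k
    rw [hΦd, Matrix.conjTranspose_sum]
    refine Finset.sum_congr rfl fun i _ => ?_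
    rw [Matrix.conjTranspose_smul, Matrix.conjTranspose_vecMulVec, star_star,
      (IsSelfAdjoint.of_nonneg (ha k i)).star_eq]
  have hE0 : ∀ k l, k ≠ l → Φd (P k) * Φd (P l) = 0 := by
    intro k l hkl
    rw [← (hPdom k (P l)).1, hPorth k l hkl, hΦd]
    simp
  have hE1 : ∑ k, Φd (P k) = 1 := by
    rw [← hTP]
    simp only [hΦd]
    rw [Finset.sum_comm]
    refine Finset.sum_congr rfl fun i _ => ?_
    rw [← Finset.sum_smul, ← dotProduct_sum, ← Matrix.sum_mulVec, hPsum, Matrix.one_mulVec, hv,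
      one_smul]
  have hkill : ∀ k l i, k ≠ l → P l *ᵥ v i ≠ 0 → Φd (P k) *ᵥ w i = 0 := by
    intro k l i hkl hne
    have h1 : Φd (P l) *ᵥ (Φd (P k) *ᵥ (Φd (P k) *ᵥ w i)) = 0 := by
      rw [Matrix.mulVec_mulVec, hE0 l k hkl.symm, Matrix.zero_mulVec]
    rw [hΦd (P l)] at h1
    have h2 := eb_aux1 w _ (ha l) _ h1 i (fun h => hne (hz l i h))
    rw [Matrix.dotProduct_mulVec] at h2
    rw [← eb_aux3, Matrix.star_mulVec, hEherm]
    exact h2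
  have hfix : ∀ l i, P l *ᵥ v i ≠ 0 → Φd (P l) *ᵥ w i = w i := by
    intro l i hne
    have h1 : (∑ k, Φd (P k)) *ᵥ w i = w i := by rw [hE1, Matrix.one_mulVec]
    rw [Matrix.sum_mulVec, Finset.sum_eq_single l] at h1
    · exact h1
    · intro k _ hkl
      exact hkill k l i hkl hne
    · simp
  have hPfix : ∀ l i, P l *ᵥ v i ≠ 0 → P l *ᵥ v i = v i := by
    intro l i hne
    have h1 : (∑ k, P k) *ᵥ v i = v i := by rw [hPsum, Matrix.one_mulVec]
    rw [Matrix.sum_mulVec, Finset.sum_eq_single l] at h1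
    · exact h1
    · intro k _ hkl
      by_contra hk
      exact hw i ((hfix l i hne).symm.trans (hkill l k i hkl.symm hk))
    · simp
  have hvne : ∀ i, v i ≠ 0 := by
    intro i h
    have := hv i
    simp [h] at this
  have hex : ∀ i, ∃ l, P l *ᵥ v i ≠ 0 := by
    intro i
    by_contra hc
    push Not at hc
    apply hvne i
    have h1 : (∑ k, P k) *ᵥ v i = v i := by rw [hPsum, Matrix.one_mulVec]
    rw [← h1, Matrix.sum_mulVec]
    exact Finset.sum_eq_zero fun k _ => hc k
  have hEQ : ∀ k l, l ≠ k → Q k * Φd (P l) = 0 := by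
    intro k l hlk
    have h1 : Φd (P l) * Q k = 0 := by
      have hsub : LinearMap.range (Q k).mulVecLin ≤ LinearMap.ker (Φd (P l)).mulVecLin := by
        rw [hQrange, Submodule.span_le]
        rintro x ⟨i, hi, rfl⟩
        have : P k *ᵥ v i ≠ 0 := by rw [hi]; exact hvne i
        simpa using hkill l k i hlk this
      apply Matrix.ext_of_mulVec_single
      intro j
      have := hsub (LinearMap.mem_range_self (Q k).mulVecLin (Pi.single j 1))
      rw [LinearMap.mem_ker, Matrix.mulVecLin_apply, Matrix.mulVecLin_apply,
        Matrix.mulVec_mulVec] at this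
      rw [this, Matrix.zero_mulVec]
    have h2 := congrArg Matrix.conjTranspose h1
    rwa [Matrix.conjTranspose_mul, hEherm, hQherm, Matrix.conjTranspose_zero] at h2
  have hdich : ∀ k i, (P k *ᵥ v i = v i ∧ Q k *ᵥ w i = w i) ∨
      (P k *ᵥ v i = 0 ∧ Q k *ᵥ w i = 0) := by
    intro k i
    by_cases hk : P k *ᵥ v i = 0
    · right
      refine ⟨hk, ?_⟩
      obtain ⟨l, hl⟩ := hex i
      have hlk : l ≠ k := by rintro rfl; exact hl hk
      rw [← hfix l i hl, Matrix.mulVec_mulVec, hEQ k l hlk, Matrix.zero_mulVec]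
    · left
      refine ⟨hPfix k i hk, ?_⟩
      have : w i ∈ LinearMap.range (Q k).mulVecLin := by
        rw [hQrange]
        exact Submodule.subset_span ⟨i, hPfix k i hk, rfl⟩
      obtain ⟨y, hy⟩ := this
      rw [Matrix.mulVecLin_apply] at hy
      rw [← hy, Matrix.mulVec_mulVec, hQidem]
  have hPl : ∀ k i, star (v i) ᵥ* P k = star (P k *ᵥ v i) := by
    intro k i
    rw [Matrix.star_mulVec, hPherm]
  have hQl : ∀ k i, star (w i) ᵥ* Q k = star (Q k *ᵥ w i) := by
    intro k i
    rw [Matrix.star_mulVec, hQherm]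
  have hA : ∀ X k, Φ (Q k * X) = P k * Φ X := by
    intro X k
    rw [hΦ, hΦ, Finset.mul_sum]
    refine Finset.sum_congr rfl fun i _ => ?_
    rw [← Matrix.mulVec_mulVec, Matrix.dotProduct_mulVec, hQl, Matrix.mul_smul,
      Matrix.mul_vecMulVec]
    rcases hdich k i with ⟨h1, h2⟩ | ⟨h1, h2⟩ <;> simp [h1, h2]
  have hB : ∀ X k, Φ X * P k = Φ (X * Q k) := by
    intro X k
    rw [hΦ, hΦ, Finset.sum_mul]
    refine Finset.sum_congr rfl fun i _ => ?_
    rw [← Matrix.mulVec_mulVec, Matrix.smul_mul, Matrix.vecMulVec_mul, hPl]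
    rcases hdich k i with ⟨h1, h2⟩ | ⟨h1, h2⟩ <;> simp [h1, h2]
  have hC : ∀ X k, P k * Φ X = Φ X * P k := by
    intro X k
    rw [hΦ, Finset.sum_mul, Finset.mul_sum]
    refine Finset.sum_congr rfl fun i _ => ?_
    rw [Matrix.smul_mul, Matrix.vecMulVec_mul, hPl, Matrix.mul_smul, Matrix.mul_vecMulVec]
    rcases hdich k i with ⟨h1, h2⟩ | ⟨h1, h2⟩ <;> simp [h1]
  refine ⟨fun X k => ⟨hA X k, hC X k, hB X k⟩, fun X k l hkl hX => ?_⟩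
  rw [hX, ← hB, hA, Matrix.mul_assoc, ← hC, ← Matrix.mul_assoc, hPorth k l hkl, Matrix.zero_mul]
end
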